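/- For every complex number d with Re(d) > 0, there holds ₄F₃(1, 1, 1, d+1; 3/2, 3, d; 1) = π²/4 + (2/d − 1). -/

import Mathlib

open scoped Nat

/-- Pochhammer symbol `(x)_k = x (x+1) ⋯ (x+k-1)` for a complex number `x`. -/
noncomputable def poch (x : ℂ) (k : ℕ) : ℂ := (ascPochhammer ℂ k).eval x

/-- The generalized hypergeometric series
`ₚF_q(a₁,…,aₚ; b₁,…,b_q; z) = ∑ₖ ((a₁)ₖ ⋯ (aₚ)ₖ)/((b₁)ₖ ⋯ (b_q)ₖ) · zᵏ/k!`. -/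
noncomputable def hyp (a b : List ℂ) (z : ℂ) : ℂ :=
  ∑' k : ℕ, ((a.map (poch · k)).prod / (b.map (poch · k)).prod) * z ^ k / (k ! : ℂ)

open Filter Topology Finset

/-- The Wallis quotient `(2n)‼ / (2n+1)‼`. -/
noncomputable def wallisQuot (n : ℕ) : ℝ := ∏ i ∈ range n, (2 * (i : ℝ) + 2) / (2 * i + 3)

lemma wallisQuot_zero : wallisQuot 0 = 1 := by simp [wallisQuot]

lemma wallisQuot_succ (n : ℕ) :
    (2 * (n : ℝ) + 3) * wallisQuot (n + 1) = (2 * n + 2) * wallisQuot n := by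
  have h : 2 * (n : ℝ) + 3 ≠ 0 := by positivity
  rw [wallisQuot, prod_range_succ, ← wallisQuot]
  field_simp

lemma wallisQuot_pos (n : ℕ) : 0 < wallisQuot n := prod_pos fun _ _ => by positivity

lemma wallisQuot_sq_le (n : ℕ) : wallisQuot n ^ 2 ≤ 1 / ((n : ℝ) + 1) := by
  induction n with
  | zero => simp [wallisQuot_zero]
  | succ n ih =>
    have h := wallisQuot_succ n
    rw [le_div_iff₀ (by positivity)] at ih ⊢
    push_cast
    have h2 : (2 * (n : ℝ) + 3) ^ 2 * wallisQuot (n + 1) ^ 2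
        = (2 * n + 2) ^ 2 * wallisQuot n ^ 2 := by
      rw [← mul_pow, h, mul_pow]
    refine le_of_mul_le_mul_left (a := (2 * (n : ℝ) + 3) ^ 2) ?_ (by positivity)
    calc (2 * (n : ℝ) + 3) ^ 2 * (wallisQuot (n + 1) ^ 2 * (n + 1 + 1))
        = 4 * ((n : ℝ) + 1) * (n + 2) * (wallisQuot n ^ 2 * (n + 1)) := by
          rw [← mul_assoc, h2]; ring
      _ ≤ 4 * ((n : ℝ) + 1) * (n + 2) * 1 := by gcongr
      _ ≤ (2 * (n : ℝ) + 3) ^ 2 * 1 := by nlinarith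

lemma tendsto_wallisQuot : Tendsto wallisQuot atTop (𝓝 0) := by
  have h : Tendsto (fun n => wallisQuot n ^ 2) atTop (𝓝 0) :=
    squeeze_zero (fun n => sq_nonneg _) wallisQuot_sq_le tendsto_one_div_add_atTop_nhds_zero_nat
  have h' := h.sqrt
  simpa [Real.sqrt_sq (wallisQuot_pos _).le] using h'

lemma hasSum_telescoping_wallisQuot :
    HasSum (fun k : ℕ => k * wallisQuot k / (((k : ℝ) + 1) * (k + 2))) 1 := by
  have hsum (n : ℕ) : ∑ k ∈ range n, k * wallisQuot k / (((k : ℝ) + 1) * (k + 2))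
      = 1 - (2 * n + 1) / (n + 1) * wallisQuot n := by
    induction n with
    | zero => simp [wallisQuot_zero]
    | succ n ih =>
      rw [sum_range_succ, ih]
      have h := wallisQuot_succ n
      have h1 : (n : ℝ) + 1 ≠ 0 := by positivity
      have h2 : (n : ℝ) + 2 ≠ 0 := by positivity
      have e : (2 * ((n + 1 : ℕ) : ℝ) + 1) / ((n + 1 : ℕ) + 1) * wallisQuot (n + 1)
          = (2 * n + 2) * wallisQuot n / (n + 2) := by
        rw [← h]; push_cast; ring_nf
      rw [e]
      field_simp
      ring
  rw [hasSum_iff_tendsto_nat_of_nonneg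
    (fun k => by have := wallisQuot_pos k; positivity)]
  simp only [hsum]
  have h0 : Tendsto (fun n : ℕ => (2 * (n : ℝ) + 1) / (n + 1) * wallisQuot n) atTop (𝓝 0) := by
    refine squeeze_zero (fun n => by have := wallisQuot_pos n; positivity) (fun n => ?_)
      (by simpa using tendsto_wallisQuot.const_mul 2)
    have := (wallisQuot_pos n).le
    gcongr
    rw [div_le_iff₀ (by positivity)]
    linarith
  simpa using h0.const_sub 1

/-- The remainder of `t = cos t * ∑ wallisQuot k * sin t ^ (2k+1)` after `n` terms. -/
noncomputable def arcsinRem (n : ℕ) (t : ℝ) : ℝ :=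
  t - Real.cos t * ∑ k ∈ range n, wallisQuot k * Real.sin t ^ (2 * k + 1)

/-- The remainder of `t ^ 2 = ∑ wallisQuot k / (k+1) * sin t ^ (2k+2)` after `n` terms. -/
noncomputable def arcsinSqRem (n : ℕ) (t : ℝ) : ℝ :=
  t ^ 2 - ∑ k ∈ range n, wallisQuot k / (k + 1) * Real.sin t ^ (2 * k + 2)

lemma hasDerivAt_arcsinRem (n : ℕ) (t : ℝ) :
    HasDerivAt (arcsinRem n) ((2 * n + 1) * wallisQuot n * Real.sin t ^ (2 * n)) t := by
  induction n with
  | zero =>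
    have : arcsinRem 0 = id := by ext; simp [arcsinRem]
    rw [this]
    simpa [wallisQuot_zero] using hasDerivAt_id t
  | succ n ih =>
    have e : arcsinRem (n + 1) = fun t => arcsinRem n t
        - Real.cos t * (wallisQuot n * Real.sin t ^ (2 * n + 1)) := by
      ext x; simp only [arcsinRem, sum_range_succ]; ring
    rw [e]
    refine (ih.sub ((Real.hasDerivAt_cos t).mul
      (((Real.hasDerivAt_sin t).pow (2 * n + 1)).const_mul (wallisQuot n)))).congr_deriv ?_
    have h := wallisQuot_succ n
    have hc := Real.cos_sq' t
    simp only [Nat.add_sub_cancel, Pi.pow_apply]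
    push_cast
    linear_combination (-Real.sin t ^ (2 * n + 2)) * h
      - (2 * n + 1) * wallisQuot n * Real.sin t ^ (2 * n) * hc

lemma hasDerivAt_arcsinSqRem (n : ℕ) (t : ℝ) :
    HasDerivAt (arcsinSqRem n) (2 * arcsinRem n t) t := by
  induction n with
  | zero =>
    have : arcsinSqRem 0 = fun x => x ^ 2 := by ext; simp [arcsinSqRem]
    rw [this]
    simpa [arcsinRem] using hasDerivAt_pow 2 t
  | succ n ih =>
    have e : arcsinSqRem (n + 1) = fun t => arcsinSqRem n t
        - wallisQuot n / (n + 1) * Real.sin t ^ (2 * n + 2) := by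
      ext x; simp only [arcsinSqRem, sum_range_succ]; ring
    rw [e]
    refine (ih.sub (((Real.hasDerivAt_sin t).pow (2 * n + 2)).const_mul _)).congr_deriv ?_
    have h1 : (n : ℝ) + 1 ≠ 0 := by positivity
    simp only [arcsinRem, sum_range_succ, show 2 * n + 2 - 1 = 2 * n + 1 by omega]
    push_cast
    field_simp
    ring

lemma arcsinSqRem_pi_div_two (n : ℕ) :
    arcsinSqRem n (Real.pi / 2)
      = Real.pi ^ 2 / 4 - ∑ k ∈ range n, wallisQuot k / ((k : ℝ) + 1) := by
  simp [arcsinSqRem]; ring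

lemma arcsinSqRem_pi_div_two_bounds (n : ℕ) :
    0 ≤ arcsinSqRem n (Real.pi / 2) ∧
      arcsinSqRem n (Real.pi / 2) ≤ Real.pi * wallisQuot n := by
  set H : ℝ → ℝ := fun t => arcsinSqRem n t + 2 * ((Real.pi / 2 - t) * arcsinRem n t) with hH
  have hpi := Real.pi_pos
  have hc := wallisQuot_pos n
  have hd (t : ℝ) : HasDerivAt H
      (2 * (Real.pi / 2 - t) * ((2 * n + 1) * wallisQuot n * Real.sin t ^ (2 * n))) t := by
    refine ((hasDerivAt_arcsinSqRem n t).add ((((hasDerivAt_id t).const_sub (Real.pi / 2)).mul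
      (hasDerivAt_arcsinRem n t)).const_mul 2)).congr_deriv ?_
    simp only [id]; ring
  have hd' (t : ℝ) : HasDerivAt (fun t => H t - Real.pi * wallisQuot n * Real.sin t ^ (2 * n + 1))
      (2 * (Real.pi / 2 - t) * ((2 * n + 1) * wallisQuot n * Real.sin t ^ (2 * n))
        - Real.pi * Real.cos t * ((2 * n + 1) * wallisQuot n * Real.sin t ^ (2 * n))) t := by
    refine ((hd t).sub (((Real.hasDerivAt_sin t).pow (2 * n + 1)).const_mul _)).congr_deriv ?_
    simp only [Nat.add_sub_cancel]; push_cast; ring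
  have h0 : H 0 = 0 := by simp [hH, arcsinSqRem, arcsinRem]
  have h1 : H (Real.pi / 2) = arcsinSqRem n (Real.pi / 2) := by simp [hH]
  have hw (t : ℝ) : 0 ≤ (2 * n + 1) * wallisQuot n * Real.sin t ^ (2 * n) := by
    rw [pow_mul]; positivity
  have hmono : MonotoneOn H (Set.Icc 0 (Real.pi / 2)) := by
    refine monotoneOn_of_deriv_nonneg (convex_Icc _ _)
      (fun x _ => (hd x).continuousAt.continuousWithinAt)
      (fun x _ => (hd x).differentiableAt.differentiableWithinAt) fun x hx => ?_
    rw [interior_Icc] at hx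
    rw [(hd x).deriv]
    exact mul_nonneg (by linarith [hx.2]) (hw x)
  have hanti : AntitoneOn (fun t => H t - Real.pi * wallisQuot n * Real.sin t ^ (2 * n + 1))
      (Set.Icc 0 (Real.pi / 2)) := by
    refine antitoneOn_of_deriv_nonpos (convex_Icc _ _)
      (fun x _ => (hd' x).continuousAt.continuousWithinAt)
      (fun x _ => (hd' x).differentiableAt.differentiableWithinAt) fun x hx => ?_
    rw [interior_Icc] at hx
    rw [(hd' x).deriv, ← sub_mul]
    refine mul_nonpos_of_nonpos_of_nonneg ?_ (hw x)
    have h := Real.mul_le_sin (x := Real.pi / 2 - x) (by linarith [hx.2]) (by linarith [hx.1])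
    rw [Real.sin_pi_div_two_sub, div_mul_eq_mul_div, div_le_iff₀ hpi] at h
    linarith
  have l0 : (0 : ℝ) ∈ Set.Icc 0 (Real.pi / 2) := ⟨le_rfl, by positivity⟩
  have l1 : Real.pi / 2 ∈ Set.Icc 0 (Real.pi / 2) := ⟨by positivity, le_rfl⟩
  constructor
  · rw [← h1, ← h0]
    exact hmono l0 l1 (by positivity)
  · have h := hanti l0 l1 (by positivity)
    simp only [h0, h1, Real.sin_zero, Real.sin_pi_div_two] at h
    simp at h
    linarith

lemma hasSum_wallisQuot_div :
    HasSum (fun k : ℕ => wallisQuot k / ((k : ℝ) + 1)) (Real.pi ^ 2 / 4) := by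
  rw [hasSum_iff_tendsto_nat_of_nonneg
    (fun k => by have := wallisQuot_pos k; positivity)]
  have h : Tendsto (fun n => arcsinSqRem n (Real.pi / 2)) atTop (𝓝 0) :=
    squeeze_zero (fun n => (arcsinSqRem_pi_div_two_bounds n).1)
      (fun n => (arcsinSqRem_pi_div_two_bounds n).2)
      (by simpa using tendsto_wallisQuot.const_mul Real.pi)
  have h' := h.const_sub (Real.pi ^ 2 / 4)
  rw [sub_zero] at h'
  refine h'.congr fun n => ?_
  rw [arcsinSqRem_pi_div_two]
  ring

lemma poch_zero (x : ℂ) : poch x 0 = 1 := by simp [poch]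

lemma poch_succ (x : ℂ) (k : ℕ) : poch x (k + 1) = poch x k * (x + k) :=
  ascPochhammer_succ_eval k x

lemma poch_one (k : ℕ) : poch 1 k = (k ! : ℂ) := by
  simp [poch, ascPochhammer_eval_one]

lemma poch_ne_zero {x : ℂ} (hx : 0 < x.re) (k : ℕ) : poch x k ≠ 0 := by
  induction k with
  | zero => simp [poch_zero]
  | succ k ih =>
    rw [poch_succ]
    refine mul_ne_zero ih fun h => ?_
    have := congrArg Complex.re h
    simp only [Complex.add_re, Complex.natCast_re, Complex.zero_re] at this
    linarith [(Nat.cast_nonneg k : (0 : ℝ) ≤ k)]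

lemma poch_add_one (x : ℂ) (k : ℕ) : x * poch (x + 1) k = poch x k * (x + k) := by
  induction k with
  | zero => simp [poch_zero]
  | succ k ih =>
    rw [poch_succ, poch_succ, ← mul_assoc, ih]
    push_cast; ring

lemma poch_three (k : ℕ) : 2 * poch 3 k = (k ! : ℂ) * (k + 1) * (k + 2) := by
  induction k with
  | zero => simp [poch_zero]
  | succ k ih =>
    rw [poch_succ, ← mul_assoc, ih, Nat.factorial_succ]
    push_cast; ring

lemma poch_three_halves_mul_wallisQuot (k : ℕ) :
    poch (3 / 2) k * (wallisQuot k : ℂ) = (k ! : ℂ) := by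
  induction k with
  | zero => simp [poch_zero, wallisQuot_zero]
  | succ k ih =>
    have h : (2 * (k : ℂ) + 3) * (wallisQuot (k + 1) : ℂ) = (2 * k + 2) * (wallisQuot k : ℂ) :=
      mod_cast congrArg (Complex.ofReal) (wallisQuot_succ k)
    rw [poch_succ, Nat.factorial_succ]
    push_cast
    linear_combination (poch (3 / 2) k / 2) * h + (k + 1) * ih

theorem watson_m0_n0_s0 (d : ℂ) (hd : 0 < d.re) :
    hyp [1, 1, 1, d + 1] [3/2, 3, d] 1 =
      (Real.pi : ℂ) ^ 2 / 4 + (2 / d - 1) := by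
  have hA := Complex.hasSum_ofReal.mpr hasSum_wallisQuot_div
  have hB := (Complex.hasSum_ofReal.mpr hasSum_telescoping_wallisQuot).mul_left (2 / d - 1)
  have hsum := hA.add hB
  push_cast at hsum
  rw [mul_one] at hsum
  rw [hyp, ← hsum.tsum_eq]
  refine tsum_congr fun k => ?_
  have hd0 : d ≠ 0 := by rintro rfl; simp at hd
  have hf : (k ! : ℂ) ≠ 0 := mod_cast k.factorial_ne_zero
  have h1 : (k : ℂ) + 1 ≠ 0 := mod_cast k.succ_ne_zero
  have h2 : (k : ℂ) + 2 ≠ 0 := mod_cast (k + 1).succ_ne_zero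
  have hpd := poch_ne_zero hd k
  have hph : poch (3 / 2) k ≠ 0 := poch_ne_zero (by norm_num) k
  have hw : (wallisQuot k : ℂ) = (k ! : ℂ) / poch (3 / 2) k := by
    rw [eq_div_iff hph, mul_comm, poch_three_halves_mul_wallisQuot]
  have h3 : poch 3 k = (k ! : ℂ) * (k + 1) * (k + 2) / 2 := by
    rw [← poch_three]; ring
  have h4 : poch (d + 1) k = poch d k * (d + k) / d := by
    rw [← poch_add_one]; field_simp
  simp only [List.map_cons, List.map_nil, List.prod_cons, List.prod_nil, poch_one, h3, h4, hw,
    one_pow]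
  field_simp
  ring
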